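/- arXiv:2312.16964 — 10 statements merged into one kernel-verified Lean document; each statement's English description precedes it below -/
import Mathlib

section
/- Let 𝓘 be a collection of n ≥ 1 intervals all having the same slope m > 0 (the moving distance function is unique), and let x_1 ≤ x_2 ≤ … ≤ x_{2n} be the 2n endpoints of the intervals of 𝓘 listed in non-decreasing order (with multiplicity). Then both x_n and x_{n+1} are optimal gathering points, i.e., D(𝓘, x_n) ≤ D(𝓘, y) and D(𝓘, x_{n+1}) ≤ D(𝓘, y) for all y ∈ ℝ. -/
/-- The distance to an interval, expressed through the distances to its endpoints. -/
theorem max_abs_sub_half_length (x c l : ℝ) (hl : 0 ≤ l) :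
    max (|x - c| - l / 2) 0 = (|x - (c - l / 2)| + |x - (c + l / 2)| - l) / 2 := by
  rcases max_cases (|x - c| - l / 2) 0 with h | h <;>
    rcases abs_cases (x - c) with h₁ | h₁ <;>
    rcases abs_cases (x - (c - l / 2)) with h₂ | h₂ <;>
    rcases abs_cases (x - (c + l / 2)) with h₃ | h₃ <;> linarith

/-- A point separating the lower half of `2 * n` reals from the upper half minimizes the sum of
the distances to them. -/
theorem sum_abs_sub_le_of_median {n : ℕ} {e : Fin (2 * n) → ℝ} {x : ℝ}
    (hlow : ∀ j : Fin (2 * n), (j : ℕ) < n → e j ≤ x)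
    (hhigh : ∀ j : Fin (2 * n), n ≤ (j : ℕ) → x ≤ e j) (y : ℝ) :
    ∑ j, |x - e j| ≤ ∑ j, |y - e j| := by
  have hrev (z : ℝ) : ∑ j : Fin (2 * n), |z - e j.rev| = ∑ j, |z - e j| :=
    Equiv.sum_comp Fin.revPerm fun j => |z - e j|
  have hpair : ∑ j, (|x - e j| + |x - e j.rev|) ≤ ∑ j, (|y - e j| + |y - e j.rev|) := by
    refine Finset.sum_le_sum fun j _ => ?_
    have hval := Fin.val_rev j
    rcases lt_or_ge (j : ℕ) n with hj | hj
    · have h₁ := hlow j hj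
      have h₂ := hhigh j.rev (by omega)
      rw [abs_of_nonneg (sub_nonneg.2 h₁), abs_of_nonpos (sub_nonpos.2 h₂)]
      linarith [le_abs_self (y - e j), neg_le_abs (y - e j.rev)]
    · have h₁ := hhigh j hj
      have h₂ := hlow j.rev (by omega)
      rw [abs_of_nonpos (sub_nonpos.2 h₁), abs_of_nonneg (sub_nonneg.2 h₂)]
      linarith [neg_le_abs (y - e j), le_abs_self (y - e j.rev)]
  simp only [Finset.sum_add_distrib, hrev] at hpair
  linarith


/-- Let `𝓘` be a collection of `n ≥ 1` intervals all having the same slope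
`m > 0`, and let `e 0 ≤ e 1 ≤ … ≤ e (2n-1)` be the `2n` endpoints of the intervals of
`𝓘` listed in non-decreasing order (with multiplicity).  Then both the `n`-th and the
`(n+1)`-th endpoints (1-indexed, i.e. `e (n-1)` and `e n`) are optimal gathering points. -/
theorem median_endpoints_are_optimal_gathering_points
    (n : ℕ) (hn : 1 ≤ n) (c len : Fin n → ℝ) (m : ℝ)
    (hlen : ∀ i, 0 < len i) (hm : 0 < m)
    (e : Fin (2 * n) → ℝ) (hmono : Monotone e)
    (hmult : Multiset.map e Finset.univ.val =
      Multiset.map (fun i => c i - len i / 2) Finset.univ.val +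
      Multiset.map (fun i => c i + len i / 2) Finset.univ.val) :
    (∀ y : ℝ, (∑ i, m * max (|e ⟨n - 1, by omega⟩ - c i| - len i / 2) 0) ≤
      ∑ i, m * max (|y - c i| - len i / 2) 0) ∧
    (∀ y : ℝ, (∑ i, m * max (|e ⟨n, by omega⟩ - c i| - len i / 2) 0) ≤
      ∑ i, m * max (|y - c i| - len i / 2) 0) := by
  have hD (x : ℝ) : ∑ i, m * max (|x - c i| - len i / 2) 0 =
      m / 2 * (∑ j, |x - e j| - ∑ i, len i) := by
    have hsum : ∑ j, |x - e j| =
        ∑ i, |x - (c i - len i / 2)| + ∑ i, |x - (c i + len i / 2)| := by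
      simpa [Finset.sum, Function.comp_def] using congrArg (fun s => (s.map fun t => |x - t|).sum) hmult
    rw [hsum, ← Finset.sum_add_distrib, ← Finset.sum_sub_distrib, Finset.mul_sum]
    refine Finset.sum_congr rfl fun i _ => ?_
    rw [max_abs_sub_half_length _ _ _ (hlen i).le]
    ring
  simp only [hD]
  refine ⟨fun y => ?_, fun y => ?_⟩ <;> gcongr ?_ * (?_ - ?_) <;>
    refine sum_abs_sub_le_of_median (fun j hj => hmono ?_) (fun j hj => hmono ?_) y <;>
    simp only [Fin.le_def] <;> omega
end

section
/- Let c_1 ≤ c_2 ≤ … ≤ c_n be the centres of a collection of n unit intervals and let 1 ≤ k ≤ n. There exist k of the intervals that pairwise intersect (the intersection graph contains a k-clique) if and only if there exists an index i with 1 ≤ i ≤ n − k + 1 such that c_{i+k−1} − c_i ≤ 1. -/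
/-- Let `c 0 ≤ c 1 ≤ … ≤ c (n-1)` be the centres of `n` unit intervals and
let `1 ≤ k ≤ n`.  There exist `k` of the intervals that pairwise intersect (the
intersection graph contains a `k`-clique) iff there is an index `i` (0-indexed, with
`i + k ≤ n`) such that `c (i+k-1) - c i ≤ 1`. -/
theorem kClique_iff_consecutive_close
    (n k : ℕ) (hk : 1 ≤ k) (hkn : k ≤ n) (c : Fin n → ℝ) (hc : Monotone c) :
    (∃ S : Finset (Fin n), S.card = k ∧ ∀ i ∈ S, ∀ j ∈ S, |c i - c j| ≤ 1) ↔
    ∃ i : ℕ, ∃ h : i + k ≤ n,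
      c ⟨i + k - 1, by omega⟩ - c ⟨i, by omega⟩ ≤ 1 := by
  constructor
  · rintro ⟨S, hS, h⟩
    have hne : S.Nonempty := Finset.card_pos.mp (by omega)
    have hcard : k ≤ (S.max' hne : ℕ) + 1 - (S.min' hne : ℕ) := by
      rw [← hS, ← Fin.card_Icc]
      exact Finset.card_le_card fun x hx =>
        Finset.mem_Icc.mpr ⟨S.min'_le x hx, S.le_max' x hx⟩
    have hlt := (S.max' hne).isLt
    refine ⟨S.min' hne, by omega, ?_⟩
    have hmono : c ⟨(S.min' hne : ℕ) + k - 1, by omega⟩ ≤ c (S.max' hne) :=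
      hc (Fin.le_def.mpr (by simp only; omega))
    have hclose := (abs_le.mp (h _ (S.max'_mem hne) _ (S.min'_mem hne))).2
    simp only [Fin.eta]
    linarith
  · rintro ⟨i, hi, h⟩
    refine ⟨Finset.Icc ⟨i, by omega⟩ ⟨i + k - 1, by omega⟩, ?_, fun a ha b hb => ?_⟩
    · simp only [Fin.card_Icc]
      omega
    · rw [Finset.mem_Icc] at ha hb
      exact (abs_sub_le_of_le_of_le (hc ha.1) (hc ha.2) (hc hb.1) (hc hb.2)).trans h
end

section
/- Let c_1 ≤ c_2 ≤ … ≤ c_n be the centres of n unit intervals, all with the same slope m > 0, and let 1 ≤ k ≤ n. Then the minimum of Σ_{i∈S} m·max(|x − c_i| − 1/2, 0) over all subsets S ⊆ {1,…,n} with |S| = k and all points x ∈ ℝ is attained by some set of k consecutive indices S = {i, i+1, …, i+k−1} (for some 1 ≤ i ≤ n − k + 1) together with some point x ∈ ℝ. -/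
/-- If `f` is quasiconvex on `ℕ`, every finite set is dominated by a block of consecutive
naturals of the same size that lies in the same range. -/
theorem exists_sum_Ico_le_of_quasiconvex {f : ℕ → ℝ}
    (hf : ∀ a b c, a ≤ b → b ≤ c → f b ≤ max (f a) (f c)) (k : ℕ) :
    ∀ (a b : ℕ) (S : Finset ℕ), a ≤ b → S ⊆ Finset.Ico a b → S.card = k →
      ∃ i, a ≤ i ∧ i + k ≤ b ∧ ∑ j ∈ Finset.Ico i (i + k), f j ≤ ∑ j ∈ S, f j := by
  induction k with
  | zero =>
    intro a b S hab _ hS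
    obtain rfl := Finset.card_eq_zero.mp hS
    exact ⟨a, le_rfl, by simpa using hab, by simp⟩
  | succ k ih =>
    intro a b S _ hSab hS
    have hne : S.Nonempty := Finset.card_pos.mp (by omega)
    set p := S.min' hne
    set q := S.max' hne
    have hp : p ∈ S := S.min'_mem hne
    have hq : q ∈ S := S.max'_mem hne
    have hpq : p ≤ q := S.min'_le q hq
    have hpa := Finset.mem_Ico.mp (hSab hp)
    have hqb := Finset.mem_Ico.mp (hSab hq)
    rcases le_total (f p) (f q) with h | h
    · have hsub : S.erase q ⊆ Finset.Ico p q := by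
        intro j hj
        obtain ⟨hjq, hj⟩ := Finset.mem_erase.mp hj
        exact Finset.mem_Ico.mpr ⟨S.min'_le j hj, lt_of_le_of_ne (S.le_max' j hj) hjq⟩
      obtain ⟨i, hi, hik, hle⟩ := ih p q _ hpq hsub
        (by rw [Finset.card_erase_of_mem hq, hS]; rfl)
      refine ⟨i, by omega, by omega, ?_⟩
      have hnew : f (i + k) ≤ f q := (hf p (i + k) q (by omega) hik).trans_eq (max_eq_right h)
      rw [← add_assoc, Finset.sum_Ico_succ_top (by omega), ← Finset.sum_erase_add _ _ hq]
      exact add_le_add hle hnew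
    · have hsub : S.erase p ⊆ Finset.Ico (p + 1) (q + 1) := by
        intro j hj
        obtain ⟨hjp, hj⟩ := Finset.mem_erase.mp hj
        have h1 := S.min'_le j hj
        have h2 := S.le_max' j hj
        exact Finset.mem_Ico.mpr ⟨lt_of_le_of_ne h1 (Ne.symm hjp), Nat.lt_succ_of_le h2⟩
      obtain ⟨i, hi, hik, hle⟩ := ih (p + 1) (q + 1) _ (by omega) hsub
        (by rw [Finset.card_erase_of_mem hp, hS]; rfl)
      obtain ⟨i, rfl⟩ : ∃ t, i = t + 1 := ⟨i - 1, by omega⟩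
      refine ⟨i, by omega, by omega, ?_⟩
      have hnew : f i ≤ f p := (hf p i q (by omega) (by omega)).trans_eq (max_eq_left h)
      rw [Finset.sum_eq_sum_Ico_succ_bot (by omega), ← Finset.add_sum_erase _ _ hp,
        show i + (k + 1) = i + 1 + k by omega]
      exact add_le_add hnew hle

/-- Along a monotone sequence of centres, the moving distance to a fixed point is quasiconvex. -/
theorem movingDistance_quasiconvex {C : ℕ → ℝ} (hC : Monotone C) {m : ℝ} (hm : 0 ≤ m) (y : ℝ)
    (a b d : ℕ) (hab : a ≤ b) (hbd : b ≤ d) :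
    m * max (|y - C b| - 1 / 2) 0 ≤
      max (m * max (|y - C a| - 1 / 2) 0) (m * max (|y - C d| - 1 / 2) 0) := by
  have h1 := hC hab
  have h2 := hC hbd
  have key : |y - C b| ≤ |y - C a| ∨ |y - C b| ≤ |y - C d| := by
    grind
  rcases key with h | h
  · exact le_max_of_le_left (by gcongr)
  · exact le_max_of_le_right (by gcongr)

/-- The cost of gathering a nonempty finite family of unit intervals attains its minimum. -/
theorem exists_gathering_point {ι : Type*} (c : ι → ℝ) {m : ℝ} (hm : 0 < m) {S : Finset ι}
    (hS : S.Nonempty) :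
    ∃ x : ℝ, ∀ y : ℝ, ∑ j ∈ S, m * max (|x - c j| - 1 / 2) 0 ≤
      ∑ j ∈ S, m * max (|y - c j| - 1 / 2) 0 := by
  obtain ⟨s, hs⟩ := hS
  refine Continuous.exists_forall_le (by fun_prop) ?_
  have hlim : Filter.Tendsto (fun x : ℝ => m * (|x| + (-|c s| - 1 / 2)))
      (Filter.cocompact ℝ) Filter.atTop :=
    (Filter.tendsto_atTop_add_const_right _ _ tendsto_norm_cocompact_atTop).const_mul_atTop hm
  refine Filter.tendsto_atTop_mono (fun x => ?_) hlim
  calc m * (|x| + (-|c s| - 1 / 2)) ≤ m * max (|x - c s| - 1 / 2) 0 := by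
        gcongr
        exact le_max_of_le_left (by linarith [abs_sub_abs_le_abs_sub x (c s)])
    _ ≤ _ := Finset.single_le_sum (f := fun j => m * max (|x - c j| - 1 / 2) 0)
        (fun j _ => by positivity) hs


/-- Let `c 0 ≤ c 1 ≤ … ≤ c (n-1)` be the centres of `n` unit intervals, all
with the same slope `m > 0`, and let `1 ≤ k ≤ n`.  The minimum of
`∑_{j ∈ S} m * max (|x - c j| - 1/2) 0` over all subsets `S` of size `k` and points
`x ∈ ℝ` is attained by some set of `k` consecutive indices together with some point. -/
theorem kClique_optimal_solution_consecutive
    (n k : ℕ) (hk : 1 ≤ k) (hkn : k ≤ n) (c : Fin n → ℝ) (hc : Monotone c)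
    (m : ℝ) (hm : 0 < m) :
    ∃ i : ℕ, ∃ _ : i + k ≤ n, ∃ x : ℝ,
      ∀ S : Finset (Fin n), S.card = k → ∀ y : ℝ,
        (∑ j ∈ Finset.univ.filter (fun j : Fin n => i ≤ (j : ℕ) ∧ (j : ℕ) < i + k),
          m * max (|x - c j| - 1 / 2) 0) ≤
        ∑ j ∈ S, m * max (|y - c j| - 1 / 2) 0 := by
  have hn : 0 < n := by omega
  let C : ℕ → ℝ := fun j => c ⟨min j (n - 1), by omega⟩
  have hC : Monotone C := fun a b hab => hc (Fin.mk_le_mk.mpr (by omega))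
  have hCc (j : Fin n) : C j = c j := congrArg c (Fin.ext (by simp; omega))
  have hwindow (i : ℕ) (hi : i + k ≤ n) (x : ℝ) :
      ∑ j ∈ Finset.univ.filter (fun j : Fin n => i ≤ (j : ℕ) ∧ (j : ℕ) < i + k),
        m * max (|x - c j| - 1 / 2) 0 =
      ∑ j ∈ Finset.Ico i (i + k), m * max (|x - C j| - 1 / 2) 0 := by
    have himage : Finset.Ico i (i + k) =
        (Finset.univ.filter (fun j : Fin n => i ≤ (j : ℕ) ∧ (j : ℕ) < i + k)).map
          Fin.valEmbedding := by
      ext j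
      simp only [Finset.mem_Ico, Finset.mem_map, Finset.mem_filter, Finset.mem_univ, true_and,
        Fin.valEmbedding_apply]
      exact ⟨fun h => ⟨⟨j, by omega⟩, h, rfl⟩, by rintro ⟨j, h, rfl⟩; exact h⟩
    simp only [himage, Finset.sum_map, Fin.valEmbedding_apply, hCc]
  have hmin (i : ℕ) := exists_gathering_point C hm (S := Finset.Ico i (i + k))
    (Finset.nonempty_Ico.mpr (by omega))
  choose x hx using hmin
  obtain ⟨i, hi, hbest⟩ := (Finset.range (n - k + 1)).exists_min_image
    (fun i => ∑ j ∈ Finset.Ico i (i + k), m * max (|x i - C j| - 1 / 2) 0) ⟨0, by simp⟩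
  have hik : i + k ≤ n := by have := Finset.mem_range.mp hi; omega
  refine ⟨i, hik, x i, fun S hS y => ?_⟩
  obtain ⟨t, -, htk, hle⟩ := exists_sum_Ico_le_of_quasiconvex
    (movingDistance_quasiconvex hC hm.le y) k 0 n (S.map Fin.valEmbedding) (Nat.zero_le n)
    (fun j hj => by
      obtain ⟨j, -, rfl⟩ := Finset.mem_map.mp hj
      exact Finset.mem_Ico.mpr ⟨Nat.zero_le _, j.isLt⟩)
    (by rw [Finset.card_map, hS])
  simp only [Finset.sum_map, Fin.valEmbedding_apply, hCc] at hle
  rw [hwindow i hik]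
  exact (hbest t (Finset.mem_range.mpr (by omega))).trans ((hx t y).trans hle)
end

section
/- Let 𝓘 be a finite collection of intervals, all with slope 1, let x_j^𝓘 and x_{j+1}^𝓘 be the j-th and (j+1)-th smallest endpoints of 𝓘 (counted with multiplicity). Then D(𝓘, x_{j+1}^𝓘) = D(𝓘, x_j^𝓘) + (x_{j+1}^𝓘 − x_j^𝓘)·(|L(𝓘, x_{j+1}^𝓘)| − |R(𝓘, x_j^𝓘)|). -/
/-- A value of a monotone finite sequence never lies strictly between two consecutive terms. -/
theorem Monotone.apply_le_or_le_apply_of_consecutive {α : Type*} [Preorder α] {m : ℕ}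
    {e : Fin m → α} (hmono : Monotone e) {p q : Fin m} (hpq : (q : ℕ) ≤ p + 1) (k : Fin m) :
    e k ≤ e p ∨ e q ≤ e k := by
  rcases le_or_gt k p with h | h
  · exact Or.inl (hmono h)
  · refine Or.inr (hmono ?_)
    rw [Fin.lt_def] at h
    rw [Fin.le_def]
    omega

/-- The change of the distance to an interval between two points that have no endpoint of the
interval strictly between them. -/
theorem max_abs_sub_sub_eq_add_mul_ite {a b c w : ℝ} (hab : a ≤ b) (hw : 0 < w)
    (hl : c - w / 2 ≤ a ∨ b ≤ c - w / 2) (hr : c + w / 2 ≤ a ∨ b ≤ c + w / 2) :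
    max (|b - c| - w / 2) 0 = max (|a - c| - w / 2) 0 +
      (b - a) * ((if c + w / 2 < b then 1 else 0) - (if a < c - w / 2 then 1 else 0)) := by
  rcases hab.eq_or_lt with rfl | hab
  · simp
  rcases hr with hr | hr
  · rw [if_pos (by linarith), if_neg (by linarith), abs_of_nonneg (by linarith),
      abs_of_nonneg (by linarith), max_eq_left (by linarith), max_eq_left (by linarith)]
    ring
  rcases hl with hl | hl
  · rw [if_neg (by linarith), if_neg (by linarith), max_eq_right, max_eq_right]
    · ring
    · rw [sub_nonpos, abs_le]
      constructor <;> linarith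
    · rw [sub_nonpos, abs_le]
      constructor <;> linarith
  · rw [if_neg (by linarith), if_pos (by linarith), abs_of_nonpos (by linarith),
      abs_of_nonpos (by linarith), max_eq_left (by linarith), max_eq_left (by linarith)]
    ring


/-- Let `𝓘` be a finite collection of intervals, all with slope 1, and let
`x_j` and `x_{j+1}` be the `j`-th and `(j+1)`-th smallest endpoints of `𝓘` (counted with
multiplicity, 1-indexed; here `e` lists the `2n` endpoints in non-decreasing order, so
`x_j = e (j-1)` and `x_{j+1} = e j`).  Then
`D(𝓘, x_{j+1}) = D(𝓘, x_j) + (x_{j+1} - x_j) * (|L(𝓘, x_{j+1})| - |R(𝓘, x_j)|)`. -/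
theorem totalMovingDistance_update_next_endpoint
    (n : ℕ) (c len : Fin n → ℝ) (hlen : ∀ i, 0 < len i)
    (e : Fin (2 * n) → ℝ) (hmono : Monotone e)
    (hmult : Multiset.map e Finset.univ.val =
      Multiset.map (fun i => c i - len i / 2) Finset.univ.val +
      Multiset.map (fun i => c i + len i / 2) Finset.univ.val)
    (j : ℕ) (hj : 1 ≤ j) (hj2 : j + 1 ≤ 2 * n) :
    (∑ i, max (|e ⟨j, by omega⟩ - c i| - len i / 2) 0) =
      (∑ i, max (|e ⟨j - 1, by omega⟩ - c i| - len i / 2) 0) +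
      (e ⟨j, by omega⟩ - e ⟨j - 1, by omega⟩) *
        (((Finset.univ.filter (fun i : Fin n => c i + len i / 2 < e ⟨j, by omega⟩)).card : ℝ) -
         ((Finset.univ.filter (fun i : Fin n => e ⟨j - 1, by omega⟩ < c i - len i / 2)).card : ℝ)) := by
  have hgap : ∀ x ∈ Multiset.map e Finset.univ.val,
      x ≤ e ⟨j - 1, by omega⟩ ∨ e ⟨j, by omega⟩ ≤ x := by
    intro x hx
    obtain ⟨k, -, rfl⟩ := Multiset.mem_map.1 hx
    exact hmono.apply_le_or_le_apply_of_consecutive (by simp only; omega) k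
  have hab : e ⟨j - 1, by omega⟩ ≤ e ⟨j, by omega⟩ := hmono (by simp [Fin.le_def])
  rw [hmult] at hgap
  rw [Finset.natCast_card_filter, Finset.natCast_card_filter, ← Finset.sum_sub_distrib,
    Finset.mul_sum, ← Finset.sum_add_distrib]
  refine Finset.sum_congr rfl fun i _ => max_abs_sub_sub_eq_add_mul_ite hab (hlen i) ?_ ?_
  · exact hgap _ (Multiset.mem_add.2 (Or.inl (Multiset.mem_map_of_mem _ (Finset.mem_univ i))))
  · exact hgap _ (Multiset.mem_add.2 (Or.inr
      (Multiset.mem_map_of_mem (fun i => c i + len i / 2) (Finset.mem_univ i))))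
end

section
/- Let 𝓘 = {I_1, …, I_n} be a collection of unit intervals with slope 1 sorted by centre (c(I_1) ≤ … ≤ c(I_n)), let I_{n+1} be a unit interval with c(I_n) ≤ c(I_{n+1}), and let 𝓙 = (𝓘 ∖ {I_1}) ∪ {I_{n+1}}. If x_n^𝓙 ≥ x_{n+1}^𝓘, then D(𝓙, x_n^𝓙) = D(𝓘, x_{n+1}^𝓘) + |x_{n+1}^𝓘 − x_n^𝓙|·(|L(𝓙, x_n^𝓙)| − |R(𝓙, x_{n+1}^𝓘)|) + d_{I_{n+1}}(x_{n+1}^𝓘) − d_{I_1}(x_{n+1}^𝓘). -/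
/-- Comparing sums over a family with sums over the two multisets whose union it enumerates. -/
theorem sum_eq_of_map_univ_eq_add {m n : ℕ} {e : Fin m → ℝ} {l r : Fin n → ℝ}
    (h : Multiset.map e Finset.univ.val =
      Multiset.map l Finset.univ.val + Multiset.map r Finset.univ.val) (f : ℝ → ℕ) :
    ∑ k, f (e k) = ∑ i, f (l i) + ∑ i, f (r i) := by
  have := congrArg (fun s => (Multiset.map f s).sum) h
  rwa [Multiset.map_add, Multiset.sum_add, Multiset.map_map, Multiset.map_map,
    Multiset.map_map] at this

/-- Shifting the window by one interval leaves no endpoint of the new window strictly between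
the `(n+1)`-st endpoint of the old window and the `n`-th endpoint of the new one. -/
theorem endpoint_le_or_ge_of_shift_window
    (n : ℕ) (c : Fin (n + 1) → ℝ)
    (eI eJ : Fin (2 * n) → ℝ) (hImono : Monotone eI) (hJmono : Monotone eJ)
    (hImult : Multiset.map eI Finset.univ.val =
      Multiset.map (fun i : Fin n => c i.castSucc - 1 / 2) Finset.univ.val +
      Multiset.map (fun i : Fin n => c i.castSucc + 1 / 2) Finset.univ.val)
    (hJmult : Multiset.map eJ Finset.univ.val =
      Multiset.map (fun i : Fin n => c i.succ - 1 / 2) Finset.univ.val +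
      Multiset.map (fun i : Fin n => c i.succ + 1 / 2) Finset.univ.val)
    (p q : Fin (2 * n)) (hp : (p : ℕ) = n) (hq : (q : ℕ) + 1 = n) (k : Fin (2 * n)) :
    eJ k ≤ eI p ∨ eJ q ≤ eJ k := by
  by_contra! ⟨hak, hkb⟩
  have hk : k < q := hJmono.reflect_lt hkb
  replace hk : (k : ℕ) < q := hk
  set a := eI p
  let f : ℝ → ℕ := fun x => if x ≤ a then 1 else 0
  have hf : ∀ x, f x ≤ 1 := fun x => by unfold f; split_ifs <;> simp
  have hI := sum_eq_of_map_univ_eq_add hImult f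
  have hJ := sum_eq_of_map_univ_eq_add hJmult f
  have hl := (Fin.sum_univ_castSucc fun i => f (c i - 1 / 2)).symm.trans
    (Fin.sum_univ_succ fun i => f (c i - 1 / 2))
  have hr := (Fin.sum_univ_castSucc fun i => f (c i + 1 / 2)).symm.trans
    (Fin.sum_univ_succ fun i => f (c i + 1 / 2))
  have hIcard : p + 1 ≤ ∑ i, f (eI i) := by
    rw [← Fin.card_Iic p, Finset.sum_boole, Nat.cast_id]
    refine Finset.card_le_card fun i hi => ?_
    simpa using hImono (Finset.mem_Iic.mp hi)
  have hJcard : ∑ i, f (eJ i) ≤ k := by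
    rw [← Fin.card_Iio k, Finset.sum_boole, Nat.cast_id]
    refine Finset.card_le_card fun i hi => ?_
    exact Finset.mem_Iio.mpr (hJmono.reflect_lt ((Finset.mem_filter.mp hi).2.trans_lt hak))
  have h₁ := hf (c 0 - 1 / 2)
  have h₂ := hf (c 0 + 1 / 2)
  omega

/-- Change of the moving distance of one unit interval between two points that have no endpoint
of the interval strictly between them. -/
theorem movingDistance_sub_eq {a b c : ℝ} (hab : a ≤ b)
    (hl : c - 1 / 2 ≤ a ∨ b ≤ c - 1 / 2) (hr : c + 1 / 2 ≤ a ∨ b ≤ c + 1 / 2) :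
    max (|b - c| - 1 / 2) 0 = max (|a - c| - 1 / 2) 0 +
      (b - a) * ((if c + 1 / 2 < b then 1 else 0) - (if a < c - 1 / 2 then 1 else 0)) := by
  rcases hab.eq_or_lt with rfl | hab
  · simp
  rcases hr with hr | hr
  · rw [if_pos (hr.trans_lt hab), if_neg (by linarith), abs_of_nonneg (by linarith),
      abs_of_nonneg (by linarith), max_eq_left (by linarith), max_eq_left (by linarith)]
    ring
  rcases hl with hl | hl
  · rw [if_neg hr.not_gt, if_neg hl.not_gt, max_eq_right, max_eq_right]
    · ring
    · linarith [abs_le.mpr (⟨by linarith, by linarith⟩ : -(1 / 2) ≤ a - c ∧ a - c ≤ 1 / 2)]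
    · linarith [abs_le.mpr (⟨by linarith, by linarith⟩ : -(1 / 2) ≤ b - c ∧ b - c ≤ 1 / 2)]
  · rw [if_neg hr.not_gt, if_pos (hab.trans_le hl), abs_of_nonpos (by linarith),
      abs_of_nonpos (by linarith), max_eq_left (by linarith), max_eq_left (by linarith)]
    ring

/-- Let `𝓘 = {I_1, …, I_n}` be a collection of unit intervals with slope 1
sorted by centre, let `I_{n+1}` be a unit interval with `c(I_n) ≤ c(I_{n+1})` (here the
centres are `c 0, …, c n` with `c` monotone; `𝓘` consists of the first `n` intervals),
and let `𝓙 = (𝓘 \ {I_1}) ∪ {I_{n+1}}` (the last `n` intervals).  The functions `eI` and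
`eJ` list the `2n` endpoints of `𝓘` and `𝓙`, respectively, in non-decreasing order, so
that `x_{n+1}^𝓘 = eI n` and `x_n^𝓙 = eJ (n-1)` (1-indexed).  If `x_n^𝓙 ≥ x_{n+1}^𝓘`,
then `D(𝓙, x_n^𝓙) = D(𝓘, x_{n+1}^𝓘) + |x_{n+1}^𝓘 - x_n^𝓙| * (|L(𝓙, x_n^𝓙)| -
|R(𝓙, x_{n+1}^𝓘)|) + d_{I_{n+1}}(x_{n+1}^𝓘) - d_{I_1}(x_{n+1}^𝓘)`. -/
theorem totalMovingDistance_update_shift_window_ge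
    (n : ℕ) (hn : 1 ≤ n) (c : Fin (n + 1) → ℝ) (hc : Monotone c)
    (eI eJ : Fin (2 * n) → ℝ) (hImono : Monotone eI) (hJmono : Monotone eJ)
    (hImult : Multiset.map eI Finset.univ.val =
      Multiset.map (fun i : Fin n => c i.castSucc - 1 / 2) Finset.univ.val +
      Multiset.map (fun i : Fin n => c i.castSucc + 1 / 2) Finset.univ.val)
    (hJmult : Multiset.map eJ Finset.univ.val =
      Multiset.map (fun i : Fin n => c i.succ - 1 / 2) Finset.univ.val +
      Multiset.map (fun i : Fin n => c i.succ + 1 / 2) Finset.univ.val)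
    (hge : eJ ⟨n - 1, by omega⟩ ≥ eI ⟨n, by omega⟩) :
    (∑ i : Fin n, max (|eJ ⟨n - 1, by omega⟩ - c i.succ| - 1 / 2) 0) =
      (∑ i : Fin n, max (|eI ⟨n, by omega⟩ - c i.castSucc| - 1 / 2) 0) +
      |eI ⟨n, by omega⟩ - eJ ⟨n - 1, by omega⟩| *
        (((Finset.univ.filter
            (fun i : Fin n => c i.succ + 1 / 2 < eJ ⟨n - 1, by omega⟩)).card : ℝ) -
         ((Finset.univ.filter
            (fun i : Fin n => eI ⟨n, by omega⟩ < c i.succ - 1 / 2)).card : ℝ)) +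
      max (|eI ⟨n, by omega⟩ - c (Fin.last n)| - 1 / 2) 0 -
      max (|eI ⟨n, by omega⟩ - c 0| - 1 / 2) 0 := by
  have hJ := endpoint_le_or_ge_of_shift_window n c eI eJ hImono hJmono hImult hJmult
    ⟨n, by omega⟩ ⟨n - 1, by omega⟩ rfl (Nat.sub_add_cancel hn)
  set a := eI ⟨n, by omega⟩
  set b := eJ ⟨n - 1, by omega⟩
  have hmem : ∀ x ∈ Multiset.map (fun i : Fin n => c i.succ - 1 / 2) Finset.univ.val +
      Multiset.map (fun i : Fin n => c i.succ + 1 / 2) Finset.univ.val, x ≤ a ∨ b ≤ x := by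
    rw [← hJmult]
    simpa using hJ
  have hl : ∀ i : Fin n, c i.succ - 1 / 2 ≤ a ∨ b ≤ c i.succ - 1 / 2 := fun i =>
    hmem _ (Multiset.mem_add.mpr (.inl (Multiset.mem_map_of_mem _ (Finset.mem_univ i))))
  have hr : ∀ i : Fin n, c i.succ + 1 / 2 ≤ a ∨ b ≤ c i.succ + 1 / 2 := fun i =>
    hmem _ (Multiset.mem_add.mpr (.inr (Multiset.mem_map_of_mem _ (Finset.mem_univ i))))
  have hshift := (Fin.sum_univ_castSucc fun i => max (|a - c i| - 1 / 2) 0).symm.trans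
    (Fin.sum_univ_succ fun i => max (|a - c i| - 1 / 2) 0)
  rw [Finset.sum_congr rfl fun i _ => movingDistance_sub_eq hge (hl i) (hr i),
    Finset.sum_add_distrib, ← Finset.mul_sum, Finset.sum_sub_distrib, Finset.sum_boole,
    Finset.sum_boole, abs_sub_comm, abs_of_nonneg (sub_nonneg.mpr hge)]
  linarith
end

section
/- Let 𝓘 = {I_1, …, I_n} be a collection of unit intervals with slope 1 sorted by centre (c(I_1) ≤ … ≤ c(I_n)), let I_{n+1} be a unit interval with c(I_n) ≤ c(I_{n+1}), and let 𝓙 = (𝓘 ∖ {I_1}) ∪ {I_{n+1}}. If x_n^𝓙 < x_{n+1}^𝓘, then, setting δ = |x_n^𝓙 − x_{n+1}^𝓘|, D(𝓙, x_n^𝓙) = D(𝓘, x_{n+1}^𝓘) + δ·(|R(𝓙, x_n^𝓙)| − |L(𝓙, x_{n+1}^𝓘)|) + d_{I_{n+1}}(x_{n+1}^𝓘) − d_{I_1}(x_{n+1}^𝓘). -/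
/-- The number of endpoints of the unit intervals with centres `c i` that are less than `y`,
read off from an enumeration `e` of these endpoints. -/
theorem card_endpoints_lt {m n : ℕ} (e : Fin m → ℝ) (c : Fin n → ℝ)
    (he : Multiset.map e Finset.univ.val =
      Multiset.map (fun i => c i - 1 / 2) Finset.univ.val +
      Multiset.map (fun i => c i + 1 / 2) Finset.univ.val) (y : ℝ) :
    (Finset.univ.filter (fun k => e k < y)).card =
      (Finset.univ.filter (fun i => c i - 1 / 2 < y)).card +
      (Finset.univ.filter (fun i => c i + 1 / 2 < y)).card := by
  have h := congrArg (Multiset.countP (· < y)) he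
  rw [Multiset.countP_add, Multiset.countP_map, Multiset.countP_map, Multiset.countP_map] at h
  exact h

/-- Moving every centre to the right does not decrease any order statistic of the endpoints. -/
theorem endpoint_le_endpoint_of_centre_le {m n : ℕ} (e f : Fin m → ℝ) (a b : Fin n → ℝ)
    (he_mono : Monotone e) (hf_mono : Monotone f)
    (he : Multiset.map e Finset.univ.val =
      Multiset.map (fun i => a i - 1 / 2) Finset.univ.val +
      Multiset.map (fun i => a i + 1 / 2) Finset.univ.val)
    (hf : Multiset.map f Finset.univ.val =
      Multiset.map (fun i => b i - 1 / 2) Finset.univ.val +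
      Multiset.map (fun i => b i + 1 / 2) Finset.univ.val)
    (hab : ∀ i, a i ≤ b i) (k : Fin m) : e k ≤ f k := by
  by_contra! hlt
  have hf_card : (Finset.Iic k).card ≤ (Finset.univ.filter (fun j => f j < e k)).card := by
    refine Finset.card_le_card fun j hj => ?_
    simp only [Finset.mem_Iic, Finset.mem_filter, Finset.mem_univ, true_and] at hj ⊢
    exact (hf_mono hj).trans_lt hlt
  have he_card : (Finset.univ.filter (fun j => e j < e k)).card ≤ (Finset.Iio k).card := by
    refine Finset.card_le_card fun j hj => ?_
    simp only [Finset.mem_Iio, Finset.mem_filter, Finset.mem_univ, true_and] at hj ⊢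
    exact he_mono.reflect_lt hj
  rw [card_endpoints_lt f b hf, Fin.card_Iic] at hf_card
  rw [card_endpoints_lt e a he, Fin.card_Iio] at he_card
  have hleft : (Finset.univ.filter (fun i => b i - 1 / 2 < e k)).card ≤
      (Finset.univ.filter (fun i => a i - 1 / 2 < e k)).card :=
    Finset.card_le_card <| Finset.monotone_filter_right _ fun i _ hi => by
      linarith [hab i]
  have hright : (Finset.univ.filter (fun i => b i + 1 / 2 < e k)).card ≤
      (Finset.univ.filter (fun i => a i + 1 / 2 < e k)).card :=
    Finset.card_le_card <| Finset.monotone_filter_right _ fun i _ hi => by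
      linarith [hab i]
  omega

/-- If no endpoint of a unit interval lies strictly between `x < y`, its moving distance
changes linearly from `y` to `x`. -/
theorem movingDistance_eq_add_of_endpoints_notMem {x y c : ℝ} (hxy : x < y)
    (hl : c - 1 / 2 ≤ x ∨ y ≤ c - 1 / 2) (hr : c + 1 / 2 ≤ x ∨ y ≤ c + 1 / 2) :
    max (|x - c| - 1 / 2) 0 = max (|y - c| - 1 / 2) 0 +
      |x - y| * ((if x < c - 1 / 2 then 1 else 0) - (if c + 1 / 2 < y then 1 else 0)) := by
  rw [abs_of_neg (sub_neg.2 hxy)]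
  rcases hl with hl | hl
  · rw [if_neg hl.not_gt]
    rcases hr with hr | hr
    · rw [if_pos (hr.trans_lt hxy), abs_of_nonneg (by linarith), abs_of_nonneg (by linarith),
        max_eq_left (by linarith), max_eq_left (by linarith)]
      ring
    · have hx : |x - c| ≤ 1 / 2 := abs_le.2 ⟨by linarith, by linarith⟩
      have hy : |y - c| ≤ 1 / 2 := abs_le.2 ⟨by linarith, by linarith⟩
      rw [if_neg hr.not_gt, max_eq_right (by linarith), max_eq_right (by linarith)]
      ring
  · rw [if_pos (hxy.trans_le hl), if_neg (by linarith), abs_of_neg (by linarith),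
      abs_of_neg (by linarith), max_eq_left (by linarith), max_eq_left (by linarith)]
    ring


/-- Let `𝓘 = {I_1, …, I_n}` be a collection of unit intervals with slope 1
sorted by centre, let `I_{n+1}` be a unit interval with `c(I_n) ≤ c(I_{n+1})` (here the
centres are `c 0, …, c n` with `c` monotone; `𝓘` consists of the first `n` intervals),
and let `𝓙 = (𝓘 \ {I_1}) ∪ {I_{n+1}}` (the last `n` intervals).  The functions `eI` and
`eJ` list the `2n` endpoints of `𝓘` and `𝓙`, respectively, in non-decreasing order, so
that `x_{n+1}^𝓘 = eI n` and `x_n^𝓙 = eJ (n-1)` (1-indexed).  If `x_n^𝓙 < x_{n+1}^𝓘`,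
then, setting `δ = |x_n^𝓙 - x_{n+1}^𝓘|`,
`D(𝓙, x_n^𝓙) = D(𝓘, x_{n+1}^𝓘) + δ * (|R(𝓙, x_n^𝓙)| - |L(𝓙, x_{n+1}^𝓘)|) +
d_{I_{n+1}}(x_{n+1}^𝓘) - d_{I_1}(x_{n+1}^𝓘)`. -/
theorem totalMovingDistance_update_shift_window_lt
    (n : ℕ) (hn : 1 ≤ n) (c : Fin (n + 1) → ℝ) (hc : Monotone c)
    (eI eJ : Fin (2 * n) → ℝ) (hImono : Monotone eI) (hJmono : Monotone eJ)
    (hImult : Multiset.map eI Finset.univ.val =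
      Multiset.map (fun i : Fin n => c i.castSucc - 1 / 2) Finset.univ.val +
      Multiset.map (fun i : Fin n => c i.castSucc + 1 / 2) Finset.univ.val)
    (hJmult : Multiset.map eJ Finset.univ.val =
      Multiset.map (fun i : Fin n => c i.succ - 1 / 2) Finset.univ.val +
      Multiset.map (fun i : Fin n => c i.succ + 1 / 2) Finset.univ.val)
    (hlt : eJ ⟨n - 1, by omega⟩ < eI ⟨n, by omega⟩) :
    (∑ i : Fin n, max (|eJ ⟨n - 1, by omega⟩ - c i.succ| - 1 / 2) 0) =
      (∑ i : Fin n, max (|eI ⟨n, by omega⟩ - c i.castSucc| - 1 / 2) 0) +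
      |eJ ⟨n - 1, by omega⟩ - eI ⟨n, by omega⟩| *
        (((Finset.univ.filter
            (fun i : Fin n => eJ ⟨n - 1, by omega⟩ < c i.succ - 1 / 2)).card : ℝ) -
         ((Finset.univ.filter
            (fun i : Fin n => c i.succ + 1 / 2 < eI ⟨n, by omega⟩)).card : ℝ)) +
      max (|eI ⟨n, by omega⟩ - c (Fin.last n)| - 1 / 2) 0 -
      max (|eI ⟨n, by omega⟩ - c 0| - 1 / 2) 0 := by
  have hle : eI ⟨n, by omega⟩ ≤ eJ ⟨n, by omega⟩ :=
    endpoint_le_endpoint_of_centre_le eI eJ (fun i => c i.castSucc) (fun i => c i.succ)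
      hImono hJmono hImult hJmult (fun i => hc i.castSucc_le_succ) _
  have hgap : ∀ z ∈ Multiset.map eJ Finset.univ.val,
      z ≤ eJ ⟨n - 1, by omega⟩ ∨ eI ⟨n, by omega⟩ ≤ z := by
    intro z hz
    obtain ⟨k, -, rfl⟩ := Multiset.mem_map.1 hz
    rcases lt_or_ge k.val n with hk | hk
    · exact Or.inl (hJmono (Fin.mk_le_mk.2 (by omega)))
    · exact Or.inr (hle.trans (hJmono (Fin.mk_le_mk.2 hk)))
  rw [hJmult] at hgap
  have hsum := Fin.sum_univ_castSucc fun i => max (|eI ⟨n, by omega⟩ - c i| - 1 / 2) 0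
  rw [Fin.sum_univ_succ] at hsum
  rw [Finset.sum_congr rfl fun i _ => movingDistance_eq_add_of_endpoints_notMem hlt
      (hgap _ (Multiset.mem_add.2 (Or.inl (Multiset.mem_map_of_mem _ (Finset.mem_univ_val i)))))
      (hgap _ (Multiset.mem_add.2 (Or.inr (Multiset.mem_map_of_mem _ (Finset.mem_univ_val i))))),
    Finset.sum_add_distrib, ← Finset.mul_sum, Finset.sum_sub_distrib, Finset.sum_boole,
    Finset.sum_boole]
  linarith
end

section
/- Let 𝓘 = {I_1, …, I_n} be a collection of unit intervals sorted by centre (c(I_1) ≤ … ≤ c(I_n)), let I_{n+1} be a unit interval with c(I_n) ≤ c(I_{n+1}), and let 𝓙 = (𝓘 ∖ {I_1}) ∪ {I_{n+1}}. Then no endpoint of any interval of 𝓘 ∪ {I_{n+1}} lies strictly between x_{n+1}^𝓘 and x_n^𝓙; moreover, x_n^𝓙 equals either ℓ(I_{n+1}) or x_{n+2}^𝓘. -/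
/-- The `i`-th entry of a monotone listing is at most `t` iff more than `i` of the listed
elements are. -/
theorem Monotone.apply_le_iff_lt_countP {α : Type*} [LinearOrder α] {N : ℕ} {e : Fin N → α}
    (he : Monotone e) (i : Fin N) (t : α) :
    e i ≤ t ↔ (i : ℕ) < (Multiset.map e Finset.univ.val).countP (· ≤ t) := by
  have hcard : (Multiset.map e Finset.univ.val).countP (· ≤ t) =
      (Finset.univ.filter fun j => e j ≤ t).card := by
    rw [Multiset.countP_map]; rfl
  rw [hcard]
  constructor
  · intro h
    have hsub : Finset.Iic i ⊆ Finset.univ.filter fun j => e j ≤ t := fun j hj => by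
      simpa using (he (Finset.mem_Iic.1 hj)).trans h
    have := Finset.card_le_card hsub
    rw [Fin.card_Iic] at this
    omega
  · intro h
    by_contra hlt
    have hsub : (Finset.univ.filter fun j => e j ≤ t) ⊆ Finset.Iio i := fun j hj => by
      rw [Finset.mem_Iio]
      by_contra hij
      exact hlt ((he (not_lt.1 hij)).trans (by simpa using hj))
    have := Finset.card_le_card hsub
    rw [Fin.card_Iio] at this
    omega

theorem Multiset.countP_le_lt_countP_le {α : Type*} [LinearOrder α] {K : Multiset α} {s p : α}
    (hp : p ∈ K) (hsp : s < p) : K.countP (· ≤ s) < K.countP (· ≤ p) := by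
  obtain ⟨L, rfl⟩ := Multiset.exists_cons_of_mem hp
  have hmono : L.countP (· ≤ s) ≤ L.countP (· ≤ p) := by
    simp only [Multiset.countP_eq_card_filter]
    exact Multiset.card_le_card
      (Multiset.monotone_filter_right L fun x (hx : x ≤ s) => hx.trans hsp.le)
  simp only [Multiset.countP_cons, le_refl, if_true, hsp.not_ge, if_false]
  omega

/-- Two multisets share the part `K`; the first also has `l₁ ≤ r₁`, the second `l₂ ≤ r₂`.
If at most `m` elements of `K` lie below `r₁` and at least `m` are at most `l₂`, then the element
of rank `m + 1` (from zero) of the first and that of rank `m` of the second are separated by no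
element of either. -/
theorem no_elements_between_of_shared_part {α : Type*} [LinearOrder α] {m N : ℕ}
    {K : Multiset α} {l₁ r₁ l₂ r₂ : α} (hr : r₁ ≤ r₂) (hl : l₁ ≤ l₂) (h₁ : l₁ ≤ r₁) (h₂ : l₂ ≤ r₂)
    (hK₁ : ∀ t < r₁, K.countP (· ≤ t) ≤ m) (hK₂ : ∀ t, l₂ ≤ t → m ≤ K.countP (· ≤ t))
    {eI eJ : Fin N → α} (hI : Monotone eI) (hJ : Monotone eJ)
    (hIK : Multiset.map eI Finset.univ.val = l₁ ::ₘ r₁ ::ₘ K)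
    (hJK : Multiset.map eJ Finset.univ.val = l₂ ::ₘ r₂ ::ₘ K)
    {i₀ i₁ i₂ : Fin N} (hi₀ : (i₀ : ℕ) = m) (hi₁ : (i₁ : ℕ) = m + 1) (hi₂ : (i₂ : ℕ) = m + 2) :
    (∀ p ∈ l₁ ::ₘ r₁ ::ₘ l₂ ::ₘ r₂ ::ₘ K,
      p ∉ Set.Ioo (min (eI i₁) (eJ i₀)) (max (eI i₁) (eJ i₀))) ∧
    (eJ i₀ = l₂ ∨ eJ i₀ = eI i₂) := by
  have ha : ∀ t, eI i₁ ≤ t ↔ r₁ ≤ t ∧ m ≤ K.countP (· ≤ t) := fun t => by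
    have := hK₁ t
    rw [hI.apply_le_iff_lt_countP, hIK, hi₁]
    simp only [Multiset.countP_cons]
    grind
  have hd : ∀ t, eI i₂ ≤ t ↔ m + 1 ≤ K.countP (· ≤ t) := fun t => by
    have := hK₁ t
    rw [hI.apply_le_iff_lt_countP, hIK, hi₂]
    simp only [Multiset.countP_cons]
    grind
  have hb : ∀ t, eJ i₀ ≤ t ↔ l₂ ≤ t ∨ m + 1 ≤ K.countP (· ≤ t) := fun t => by
    have := hK₂ t
    rw [hJ.apply_le_iff_lt_countP, hJK, hi₀]
    simp only [Multiset.countP_cons]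
    grind
  have hmin : eJ i₀ = min l₂ (eI i₂) :=
    eq_of_forall_ge_iff fun t => by rw [hb, min_le_iff, hd]
  refine ⟨fun p hp hmem => ?_, ?_⟩
  · have hlt := fun s (h : s < p) (hpK : p ∈ K) => Multiset.countP_le_lt_countP_le hpK h
    have haa := (ha (eI i₁)).1 le_rfl
    have hbb := (hb (eJ i₀)).1 le_rfl
    have hap := ha p
    have hab := ha (eJ i₀)
    have hbp := hb p
    have hKp := hK₁ p
    have hKb := hK₁ (eJ i₀)
    have hla := hlt (eI i₁)
    have hlb := hlt (eJ i₀)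
    have hKlb := hK₂ (eJ i₀)
    simp only [Multiset.mem_cons] at hp
    rcases le_total (eI i₁) (eJ i₀) with h | h
    · rw [min_eq_left h, max_eq_right h] at hmem
      obtain ⟨hm₁, hm₂⟩ := hmem
      grind
    · rw [min_eq_right h, max_eq_left h] at hmem
      obtain ⟨hm₁, hm₂⟩ := hmem
      grind
  · rw [hmin]
    exact min_choice _ _

/-- Let `𝓘 = {I_1, …, I_n}` be a collection of unit intervals sorted by
centre, let `I_{n+1}` be a unit interval with `c(I_n) ≤ c(I_{n+1})` (here the centres
are `c 0, …, c n` with `c` monotone; `𝓘` consists of the first `n` intervals), and let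
`𝓙 = (𝓘 \ {I_1}) ∪ {I_{n+1}}` (the last `n` intervals).  The functions `eI` and `eJ`
list the `2n` endpoints of `𝓘` and `𝓙` in non-decreasing order, so that
`x_{n+1}^𝓘 = eI n`, `x_{n+2}^𝓘 = eI (n+1)` and `x_n^𝓙 = eJ (n-1)` (1-indexed).
Then no endpoint of any interval of `𝓘 ∪ {I_{n+1}}` lies strictly between `x_{n+1}^𝓘`
and `x_n^𝓙`; moreover, `x_n^𝓙` equals either `ℓ(I_{n+1})` or `x_{n+2}^𝓘`. -/
theorem no_endpoints_between_medians
    (n : ℕ) (hn : 2 ≤ n) (c : Fin (n + 1) → ℝ) (hc : Monotone c)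
    (eI eJ : Fin (2 * n) → ℝ) (hImono : Monotone eI) (hJmono : Monotone eJ)
    (hImult : Multiset.map eI Finset.univ.val =
      Multiset.map (fun i : Fin n => c i.castSucc - 1 / 2) Finset.univ.val +
      Multiset.map (fun i : Fin n => c i.castSucc + 1 / 2) Finset.univ.val)
    (hJmult : Multiset.map eJ Finset.univ.val =
      Multiset.map (fun i : Fin n => c i.succ - 1 / 2) Finset.univ.val +
      Multiset.map (fun i : Fin n => c i.succ + 1 / 2) Finset.univ.val) :
    (∀ i : Fin (n + 1),
      (c i - 1 / 2) ∉ Set.Ioo (min (eI ⟨n, by omega⟩) (eJ ⟨n - 1, by omega⟩))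
        (max (eI ⟨n, by omega⟩) (eJ ⟨n - 1, by omega⟩)) ∧
      (c i + 1 / 2) ∉ Set.Ioo (min (eI ⟨n, by omega⟩) (eJ ⟨n - 1, by omega⟩))
        (max (eI ⟨n, by omega⟩) (eJ ⟨n - 1, by omega⟩))) ∧
    (eJ ⟨n - 1, by omega⟩ = c (Fin.last n) - 1 / 2 ∨
      eJ ⟨n - 1, by omega⟩ = eI ⟨n + 1, by omega⟩) := by
  obtain ⟨m, rfl⟩ : ∃ m, n = m + 1 := ⟨n - 1, by omega⟩
  set K : Multiset ℝ :=
    Multiset.map (fun i : Fin m => c i.succ.castSucc - 1 / 2) Finset.univ.val +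
      Multiset.map (fun i : Fin m => c i.succ.castSucc + 1 / 2) Finset.univ.val with hK
  have hcount : ∀ t, K.countP (· ≤ t) =
      (Finset.univ.filter fun i : Fin m => c i.succ.castSucc - 1 / 2 ≤ t).card +
      (Finset.univ.filter fun i : Fin m => c i.succ.castSucc + 1 / 2 ≤ t).card := fun t => by
    rw [hK, Multiset.countP_add, Multiset.countP_map, Multiset.countP_map]; rfl
  have hIK : Multiset.map eI Finset.univ.val = (c 0 - 1 / 2) ::ₘ (c 0 + 1 / 2) ::ₘ K := by
    rw [hImult, hK, Fin.univ_succ]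
    simp [Function.comp_def]
  have hJK : Multiset.map eJ Finset.univ.val =
      (c (Fin.last _) - 1 / 2) ::ₘ (c (Fin.last _) + 1 / 2) ::ₘ K := by
    rw [hJmult, hK, Fin.univ_castSuccEmb]
    simp [Function.comp_def]
  have h0 : ∀ i, c 0 ≤ c i := fun i => hc (Fin.zero_le i)
  have hlast : ∀ i, c i ≤ c (Fin.last _) := fun i => hc (Fin.le_last i)
  have hlow : ∀ t, c (Fin.last _) - 1 / 2 ≤ t →
      (Finset.univ.filter fun i : Fin m => c i.succ.castSucc - 1 / 2 ≤ t).card = m := by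
    intro t ht
    rw [Finset.filter_true_of_mem fun i _ => by linarith [hlast i.succ.castSucc]]
    simp
  obtain ⟨hgap, hmed⟩ := no_elements_between_of_shared_part (m := m) (K := K)
    (l₁ := c 0 - 1 / 2) (r₁ := c 0 + 1 / 2)
    (l₂ := c (Fin.last _) - 1 / 2) (r₂ := c (Fin.last _) + 1 / 2)
    (by linarith [hlast 0]) (by linarith [hlast 0]) (by linarith) (by linarith)
    (fun t ht => by
      rw [hcount, Finset.filter_false_of_mem (p := fun i : Fin m => c i.succ.castSucc + 1 / 2 ≤ t)
        fun i _ => by linarith [h0 i.succ.castSucc]]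
      simpa using Finset.card_filter_le (Finset.univ : Finset (Fin m)) _)
    (fun t ht => by rw [hcount, hlow t ht]; omega)
    hImono hJmono hIK hJK
    (i₀ := ⟨m + 1 - 1, by omega⟩) (i₁ := ⟨m + 1, by omega⟩) (i₂ := ⟨m + 1 + 1, by omega⟩)
    rfl rfl rfl
  refine ⟨fun i => ?_, hmed⟩
  constructor <;> apply hgap
  all_goals
    induction i using Fin.lastCases with
    | last => simp
    | cast i =>
      induction i using Fin.cases with
      | zero => simp
      | succ i => simp [hK]
end

section
/- Let a ≤ b be real numbers and let d_i, d_j be reals with a + d_i ≥ b + d_j. Then |(b − a) + d_j| + |(a − b) + d_i| ≤ |d_i| + |d_j|. (Consequently, replacing the displacement d_i of the interval centred at a by (b − a) + d_j and the displacement d_j of the interval centred at b by (a − b) + d_i produces the same pair of moved positions {a + d_i, b + d_j} at no greater total cost.) -/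
/-- Let `a ≤ b` be real numbers and let `di, dj` be reals with
`a + di ≥ b + dj`.  Then `|(b - a) + dj| + |(a - b) + di| ≤ |di| + |dj|`.
(Swapping the targets of the two displacements produces the same pair of moved
positions at no greater total cost.) -/
theorem swap_displacements_cost_le
    (a b di dj : ℝ) (hab : a ≤ b) (h : b + dj ≤ a + di) :
    |(b - a) + dj| + |(a - b) + di| ≤ |di| + |dj| := by
  rcases abs_cases ((b - a) + dj) with h1 | h1 <;>
  rcases abs_cases ((a - b) + di) with h2 | h2 <;>
  linarith [le_abs_self di, neg_le_abs di, le_abs_self dj, neg_le_abs dj]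
end

section
/- Let c_1 ≤ c_2 ≤ … ≤ c_n be reals and let d ∈ ℝⁿ be any displacement vector. Then there exists a displacement vector d' ∈ ℝⁿ such that (i) Σ_{i=1}^n |d'_i| ≤ Σ_{i=1}^n |d_i|, (ii) the multiset {c_1 + d'_1, …, c_n + d'_n} equals the multiset {c_1 + d_1, …, c_n + d_n}, and (iii) c_1 + d'_1 ≤ c_2 + d'_2 ≤ … ≤ c_n + d'_n. -/
theorem abs_sub_add_abs_sub_le_of_le_of_le {a b x y : ℝ} (hab : a ≤ b) (hxy : x ≤ y) :
    |x - a| + |y - b| ≤ |y - a| + |x - b| := by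
  rcases abs_cases (x - a) with h₁ | h₁ <;> rcases abs_cases (y - b) with h₂ | h₂ <;>
    rcases abs_cases (y - a) with h₃ | h₃ <;> rcases abs_cases (x - b) with h₄ | h₄ <;> linarith

theorem sum_abs_comp_swap_sub_le {ι : Type*} [Fintype ι] [DecidableEq ι] {c g : ι → ℝ} {i j : ι}
    (hij : i ≠ j) (hc : c i ≤ c j) (hg : g j ≤ g i) :
    ∑ k, |g (Equiv.swap i j k) - c k| ≤ ∑ k, |g k - c k| := by
  have hj : j ∈ Finset.univ.erase i := by simp [hij.symm]
  have split (f : ι → ℝ) :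
      ∑ k, f k = f i + (f j + ∑ k ∈ (Finset.univ.erase i).erase j, f k) := by
    rw [Finset.add_sum_erase _ _ hj, Finset.add_sum_erase _ _ (Finset.mem_univ i)]
  rw [split, split fun k => |g k - c k|, Equiv.swap_apply_left, Equiv.swap_apply_right]
  have rest : ∑ k ∈ (Finset.univ.erase i).erase j, |g (Equiv.swap i j k) - c k| =
      ∑ k ∈ (Finset.univ.erase i).erase j, |g k - c k| := by
    refine Finset.sum_congr rfl fun k hk => ?_
    simp only [Finset.mem_erase, Finset.mem_univ, and_true] at hk
    rw [Equiv.swap_apply_of_ne_of_ne hk.2 hk.1]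
  linarith [abs_sub_add_abs_sub_le_of_le_of_le hc hg]

theorem sum_abs_comp_sort_sub_le {n : ℕ} {c : Fin n → ℝ} (hc : Monotone c) (f : Fin n → ℝ) :
    ∑ i, |f (Tuple.sort f i) - c i| ≤ ∑ i, |f i - c i| :=
  Tuple.bubble_sort_induction (P := fun g => ∑ i, |g i - c i| ≤ ∑ i, |f i - c i|) le_rfl
    fun g _ _ hij hg h =>
      (sum_abs_comp_swap_sub_le (g := g) hij.ne (hc hij.le) hg.le).trans h

/-- Let `c 0 ≤ c 1 ≤ … ≤ c (n-1)` be reals and let `d` be any displacement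
vector.  Then there is a displacement vector `d'` with (i) total cost at most that of
`d`, (ii) the same multiset of moved positions, and (iii) the moved positions
`c i + d' i` in non-decreasing order. -/
theorem exists_order_preserving_displacement
    (n : ℕ) (c : Fin n → ℝ) (hc : Monotone c) (d : Fin n → ℝ) :
    ∃ d' : Fin n → ℝ,
      (∑ i, |d' i|) ≤ (∑ i, |d i|) ∧
      Multiset.map (fun i => c i + d' i) Finset.univ.val =
        Multiset.map (fun i => c i + d i) Finset.univ.val ∧
      Monotone (fun i => c i + d' i) := by
  set f : Fin n → ℝ := fun i => c i + d i with hf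
  refine ⟨fun i => f (Tuple.sort f i) - c i, ?_, ?_, ?_⟩
  · simpa [hf] using sum_abs_comp_sort_sub_le hc f
  · simp only [add_sub_cancel]
    conv_rhs => rw [← Multiset.map_univ_val_equiv (Tuple.sort f), Multiset.map_map]
    rfl
  · simp only [add_sub_cancel]
    exact Tuple.monotone_sort f
end

section
/- Let c_1 ≤ c_2 ≤ … ≤ c_n be the centres of n unit intervals and let k ≥ 2. Then the infimum of Σ_{i=1}^n |d_i| over all d ∈ ℝⁿ such that no k of the moved unit intervals [c_i + d_i − 1/2, c_i + d_i + 1/2] pairwise intersect (the resulting intersection graph contains no k-clique) equals the infimum of Σ_{i=1}^n |d_i| over all d ∈ ℝⁿ satisfying (c_{i+k−1} + d_{i+k−1}) − (c_i + d_i) > 1 for all 1 ≤ i ≤ n − k + 1. -/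
theorem sum_abs_sub_comp_sort_le {n : ℕ} (c y : Fin n → ℝ) (hc : Monotone c) :
    ∑ i, |y (Tuple.sort y i) - c i| ≤ ∑ i, |y i - c i| := by
  refine Tuple.bubble_sort_induction (f := y)
    (P := fun g => ∑ i, |g i - c i| ≤ ∑ i, |y i - c i|) le_rfl ?_
  intro g i j hij hlt h
  refine le_trans ?_ h
  rw [← sub_nonpos, ← Finset.sum_sub_distrib,
    Finset.sum_eq_add i j hij.ne (fun x _ hx => by
      simp [Equiv.swap_apply_of_ne_of_ne hx.1 hx.2]) (by simp) (by simp)]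
  have hcij : c i ≤ c j := hc hij.le
  simp only [Function.comp_apply, Equiv.swap_apply_left, Equiv.swap_apply_right]
  rcases abs_cases (g i - c i) with h1 | h1 <;> rcases abs_cases (g i - c j) with h2 | h2 <;>
    rcases abs_cases (g j - c i) with h3 | h3 <;> rcases abs_cases (g j - c j) with h4 | h4 <;>
    linarith

/-- If `y (i + m) > y i + 1` for all `i`, then indices in the same residue class modulo `m`
have values more than `1` apart. -/
theorem one_lt_sub_of_modEq {n m : ℕ} (y : Fin n → ℝ)
    (hy : ∀ i j : Fin n, (j : ℕ) = i + m → 1 < y j - y i) {i j : Fin n} (hij : i < j)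
    (hmod : (i : ℕ) % m = j % m) : 1 < y j - y i := by
  have key : ∀ t : ℕ, ∀ j : Fin n, (j : ℕ) = i + m * (t + 1) → 1 < y j - y i := by
    intro t
    induction t with
    | zero => intro j hj; exact hy i j (by simpa using hj)
    | succ t ih =>
      intro j hj
      have hlt : (i : ℕ) + m * (t + 1) < n := by
        have := j.isLt
        rw [hj] at this
        nlinarith
      have h1 := ih ⟨_, hlt⟩ rfl
      have h2 := hy ⟨_, hlt⟩ j (by simp only [hj]; ring)
      linarith
  obtain ⟨t, ht⟩ := (Nat.modEq_iff_dvd' hij.le).mp hmod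
  have hlt : (i : ℕ) < j := hij
  cases t with
  | zero => simp at ht; omega
  | succ t => exact key t j (by omega)

theorem card_le_of_abs_sub_le_one {n m : ℕ} (hm : 0 < m) (y : Fin n → ℝ)
    (hy : ∀ i j : Fin n, (j : ℕ) = i + m → 1 < y j - y i) (S : Finset (Fin n))
    (hS : ∀ i ∈ S, ∀ j ∈ S, |y i - y j| ≤ 1) : S.card ≤ m := by
  by_contra! hcard
  obtain ⟨i, hi, j, hj, hne, hmod⟩ := Finset.exists_ne_map_eq_of_card_lt_of_maps_to
    (t := Finset.range m) (f := fun i : Fin n => (i : ℕ) % m) (by simpa using hcard)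
    (fun i _ => by simpa using Nat.mod_lt _ hm)
  have h := abs_le.mp (hS i hi j hj)
  rcases lt_or_gt_of_ne hne with hlt | hlt
  · linarith [one_lt_sub_of_modEq y hy hlt hmod]
  · linarith [one_lt_sub_of_modEq y hy hlt hmod.symm]

/-- If no `k` values of `y` are pairwise within distance `1`, then after sorting, values `k - 1`
positions apart differ by more than `1`. -/
theorem one_lt_sub_comp_sort {n k : ℕ} (hk : 1 ≤ k) (y : Fin n → ℝ)
    (hy : ¬ ∃ S : Finset (Fin n), S.card = k ∧ ∀ i ∈ S, ∀ j ∈ S, |y i - y j| ≤ 1)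
    {i j : Fin n} (hij : (j : ℕ) + 1 = i + k) :
    1 < y (Tuple.sort y j) - y (Tuple.sort y i) := by
  have hmono : Monotone (y ∘ Tuple.sort y) := Tuple.monotone_sort y
  by_contra! hle
  refine hy ⟨(Finset.Icc i j).map (Tuple.sort y).toEmbedding, ?_, ?_⟩
  · rw [Finset.card_map, Fin.card_Icc]; omega
  · simp only [Finset.mem_map, Finset.mem_Icc, Equiv.coe_toEmbedding]
    rintro _ ⟨a, ⟨ha, ha'⟩, rfl⟩ _ ⟨b, ⟨hb, hb'⟩, rfl⟩
    have h1 := hmono ha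
    have h2 := hmono ha'
    have h3 := hmono hb
    have h4 := hmono hb'
    simp only [Function.comp_apply] at h1 h2 h3 h4
    rw [abs_le]
    constructor <;> linarith

theorem sInf_eq_sInf_of_subset_of_forall_exists_le {A B : Set ℝ} (hB : BddBelow A) (hBA : B ⊆ A)
    (h : ∀ a ∈ A, ∃ b ∈ B, b ≤ a) : sInf A = sInf B := by
  rcases B.eq_empty_or_nonempty with rfl | hne
  · have : A = ∅ := Set.eq_empty_of_forall_notMem fun a ha => by simpa using h a ha
    rw [this]
  · refine le_antisymm (csInf_le_csInf hB hne hBA) (le_csInf (hne.mono hBA) fun a ha => ?_)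
    obtain ⟨b, hb, hba⟩ := h a ha
    exact (csInf_le (hB.mono hBA) hb).trans hba


/-- Let `c 0 ≤ … ≤ c (n-1)` be the centres of `n` unit intervals and
`k ≥ 2`.  The infimum of `∑ |d i|` over all displacement vectors `d` such that no `k` of
the moved unit intervals pairwise intersect (no `k`-clique in the intersection graph)
equals the infimum of `∑ |d i|` over all `d` satisfying
`(c (i+k-1) + d (i+k-1)) - (c i + d i) > 1` for all `i` with `i + k ≤ n` (0-indexed). -/
theorem no_kClique_LP_infimum_eq
    (n k : ℕ) (hk : 2 ≤ k) (c : Fin n → ℝ) (hc : Monotone c) :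
    sInf {t : ℝ | ∃ d : Fin n → ℝ,
        (¬ ∃ S : Finset (Fin n), S.card = k ∧
          ∀ i ∈ S, ∀ j ∈ S, |(c i + d i) - (c j + d j)| ≤ 1) ∧
        t = ∑ i, |d i|} =
    sInf {t : ℝ | ∃ d : Fin n → ℝ,
        (∀ i : ℕ, ∀ h : i + k ≤ n,
          1 < (c ⟨i + k - 1, by omega⟩ + d ⟨i + k - 1, by omega⟩) -
              (c ⟨i, by omega⟩ + d ⟨i, by omega⟩)) ∧
        t = ∑ i, |d i|} := by
  refine sInf_eq_sInf_of_subset_of_forall_exists_le ⟨0, ?_⟩ ?_ ?_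
  · rintro _ ⟨d, -, rfl⟩
    exact Finset.sum_nonneg fun i _ => abs_nonneg _
  · rintro _ ⟨d, hd, rfl⟩
    refine ⟨d, ?_, rfl⟩
    rintro ⟨S, hcard, hS⟩
    have hle := card_le_of_abs_sub_le_one (m := k - 1) (by omega) (fun i => c i + d i) ?_ S hS
    · omega
    · intro i j hij
      have h := hd i (by omega)
      have hj : (⟨i + k - 1, by omega⟩ : Fin n) = j := Fin.ext (by simp only; omega)
      rwa [hj] at h
  · rintro _ ⟨d, hd, rfl⟩
    let y : Fin n → ℝ := fun i => c i + d i
    refine ⟨_, ⟨fun i => y (Tuple.sort y i) - c i, fun i hi => ?_, rfl⟩, ?_⟩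
    · simp only [add_sub_cancel]
      exact one_lt_sub_comp_sort (by omega) y hd (by simp only; omega)
    · simpa [y] using sum_abs_sub_comp_sort_le c y hc
end
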